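/- Let μ/λ be a fixed (shifted or unshifted) skew shape with n cells, let P and Q be standard skew tableaux of shape μ/λ, and let π be a permutation of {1,…,n}. Then the set of permutations {π ∈ S_n : MJ_P(P_π) = Q} equals the set {π ∈ S_n : MJ_Q(Q_{π⁻¹}) = P}. -/

import Mathlib

open scoped Classical

/-- A (possibly shifted) skew Ferrers shape `μ/λ`, given by two partitions
`μ ⊇ λ` (with distinct parts in the shifted case). -/
structure SkewShape where
  shifted : Bool
  mu : ℕ → ℕ
  lam : ℕ → ℕ
  mu_anti : ∀ i, mu (i + 1) ≤ mu i
  lam_anti : ∀ i, lam (i + 1) ≤ lam i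
  lam_le_mu : ∀ i, lam i ≤ mu i
  mu_fin : ∃ r, ∀ i, r ≤ i → mu i = 0
  mu_strict : shifted = true → ∀ i, mu (i + 1) ≠ 0 → mu (i + 1) < mu i
  lam_strict : shifted = true → ∀ i, lam (i + 1) ≠ 0 → lam (i + 1) < lam i

/-- The set of cells of the (shifted) skew Ferrers diagram (rows and columns
are 0-indexed; in the shifted case row `i` is indented by `i` cells). -/
def SkewShape.cells (sh : SkewShape) : Set (ℕ × ℕ) :=
  {c | if sh.shifted = true then
         c.1 + sh.lam c.1 ≤ c.2 ∧ c.2 < c.1 + sh.mu c.1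
       else sh.lam c.1 ≤ c.2 ∧ c.2 < sh.mu c.1}

/-- A tabloid of shape `D`: a bijective filling of the cells of `D` with the
integers `1,…,n` where `n = |D|` (normalized to be `0` outside `D`). -/
def IsTabloid (D : Set (ℕ × ℕ)) (f : ℕ × ℕ → ℕ) : Prop :=
  Set.BijOn f D (Set.Icc 1 D.ncard) ∧ ∀ c, c ∉ D → f c = 0

/-- A standard (skew) tableau: a tabloid with increasing rows and columns. -/
def IsStandard (D : Set (ℕ × ℕ)) (f : ℕ × ℕ → ℕ) : Prop :=
  IsTabloid D f ∧ ∀ c ∈ D,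
    ((c.1, c.2 + 1) ∈ D → f c < f (c.1, c.2 + 1)) ∧
    ((c.1 + 1, c.2) ∈ D → f c < f (c.1 + 1, c.2))

/-- Exchange the entries of two cells. -/
def swapCells (f : ℕ × ℕ → ℕ) (a b : ℕ × ℕ) : ℕ × ℕ → ℕ :=
  Function.update (Function.update f a (f b)) b (f a)

/-- The value of a cell, `⊤` ("infinity") outside the shape `D`. -/
noncomputable def jval (D : Set (ℕ × ℕ)) (f : ℕ × ℕ → ℕ) (c : ℕ × ℕ) : WithTop ℕ :=
  if c ∈ D then (f c : WithTop ℕ) else ⊤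

/-- One step of forward jeu de taquin: the cell whose entry the moving entry at
`c` is exchanged with (the smaller of the right and lower neighbours, cells
outside the shape counting as `∞`), provided the moving entry is not yet
stable; `none` if it is stable. -/
noncomputable def fjTarget (D : Set (ℕ × ℕ)) (f : ℕ × ℕ → ℕ) (c : ℕ × ℕ) :
    Option (ℕ × ℕ) :=
  let r := (c.1, c.2 + 1)
  let d := (c.1 + 1, c.2)
  if min (jval D f r) (jval D f d) < jval D f c then
    some (if jval D f r ≤ jval D f d then r else d)
  else none

/-- Iterated forward jeu de taquin on a pair of fillings, starting at cell `c`: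
the moves are driven by the first filling and the exchanges are performed
simultaneously in both fillings. -/
noncomputable def fjIter (D : Set (ℕ × ℕ)) :
    ℕ → ((ℕ × ℕ → ℕ) × (ℕ × ℕ → ℕ)) → ℕ × ℕ →
      ((ℕ × ℕ → ℕ) × (ℕ × ℕ → ℕ)) × (ℕ × ℕ)
  | 0, p, c => (p, c)
  | fuel + 1, p, c =>
    match fjTarget D p.1 c with
    | none => (p, c)
    | some c' => fjIter D fuel (swapCells p.1 c c', swapCells p.2 c c') c'

/-- Forward jeu de taquin in a single filling, starting at cell `c`. -/
noncomputable def fjRun (D : Set (ℕ × ℕ)) (f : ℕ × ℕ → ℕ) (c : ℕ × ℕ) :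
    ℕ × ℕ → ℕ :=
  ((fjIter D D.ncard (f, f) c).1).1

/-- The cell of the shape `D` carrying the entry `v` of the filling `f`. -/
noncomputable def cellOf (D : Set (ℕ × ℕ)) (f : ℕ × ℕ → ℕ) (v : ℕ) : ℕ × ℕ :=
  Classical.epsilon fun c => c ∈ D ∧ f c = v

/-- `MJaux D S n k T`: perform forward jeu de taquin with the entries of `T`
lying in the cells labelled `n, n-1, …, n-k+1` in `S`, in this order. -/
noncomputable def MJaux (D : Set (ℕ × ℕ)) (S : ℕ × ℕ → ℕ) (n : ℕ) :
    ℕ → (ℕ × ℕ → ℕ) → ℕ × ℕ → ℕ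
  | 0, T => T
  | k + 1, T => fjRun D (MJaux D S n k T) (cellOf D S (n - k))

/-- Modified jeu de taquin `MJ_S(T)`: perform forward jeu de taquin with the
entries of `T` in decreasing order of the labels `S` assigns to their cells. -/
noncomputable def MJ (D : Set (ℕ × ℕ)) (S T : ℕ × ℕ → ℕ) : ℕ × ℕ → ℕ :=
  MJaux D S D.ncard D.ncard T

/-- `FJaux D S₀ n k (T,S)`: perform forward jeu de taquin with the entries of the
first component in the cells labelled `n, n-1, …, n-k+1` in the fixed standard
tableau `S₀` (in this order), all transpositions being performed simultaneously
in the second component. -/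
noncomputable def FJaux (D : Set (ℕ × ℕ)) (S0 : ℕ × ℕ → ℕ) (n : ℕ) :
    ℕ → ((ℕ × ℕ → ℕ) × (ℕ × ℕ → ℕ)) → (ℕ × ℕ → ℕ) × (ℕ × ℕ → ℕ)
  | 0, p => p
  | k + 1, p => (fjIter D D.ncard (FJaux D S0 n k p) (cellOf D S0 (n - k))).1

/-- `FJ(T,S) = (S',T')`, where `T' = MJ_S(T)` and `S'` is obtained from `S` by
simultaneously performing all transpositions applied to `T` during modified
jeu de taquin with respect to `S`. -/
noncomputable def FJ (D : Set (ℕ × ℕ)) (T S : ℕ × ℕ → ℕ) :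
    (ℕ × ℕ → ℕ) × (ℕ × ℕ → ℕ) :=
  Prod.swap (FJaux D S D.ncard D.ncard (T, S))

/-- One step of backward jeu de taquin inside the subshape `E`: the cell whose
entry the moving entry at `c` is exchanged with (the larger of the left and
upper neighbours inside `E`, missing neighbours counting as `0`), provided such
a neighbour exists; `none` otherwise. -/
noncomputable def bjTarget (E : Set (ℕ × ℕ)) (f : ℕ × ℕ → ℕ) (c : ℕ × ℕ) :
    Option (ℕ × ℕ) :=
  let l := (c.1, c.2 - 1)
  let u := (c.1 - 1, c.2)
  let vl : ℕ := if 0 < c.2 ∧ l ∈ E then f l else 0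
  let vu : ℕ := if 0 < c.1 ∧ u ∈ E then f u else 0
  if (0 < c.2 ∧ l ∈ E) ∨ (0 < c.1 ∧ u ∈ E) then
    some (if vu ≤ vl then l else u)
  else none

/-- Iterated backward jeu de taquin inside the subshape `E` on a pair of
fillings, starting at cell `c`: the moves are driven by the first filling and
the exchanges are performed simultaneously in both fillings. -/
noncomputable def bjIter (E : Set (ℕ × ℕ)) :
    ℕ → ((ℕ × ℕ → ℕ) × (ℕ × ℕ → ℕ)) → ℕ × ℕ →
      ((ℕ × ℕ → ℕ) × (ℕ × ℕ → ℕ)) × (ℕ × ℕ)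
  | 0, p, c => (p, c)
  | fuel + 1, p, c =>
    match bjTarget E p.1 c with
    | none => (p, c)
    | some c' => bjIter E fuel (swapCells p.1 c c', swapCells p.2 c c') c'

/-- The elementary forward step `Jⁱ` on a pair `(T,S)`: forward jeu de taquin in
`T` with the entry lying in the cell labelled `i` in `S`, the transpositions
being performed simultaneously in `S`. -/
noncomputable def Jfwd (D : Set (ℕ × ℕ)) (i : ℕ)
    (p : (ℕ × ℕ → ℕ) × (ℕ × ℕ → ℕ)) : (ℕ × ℕ → ℕ) × (ℕ × ℕ → ℕ) :=
  (fjIter D D.ncard p (cellOf D p.2 i)).1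

/-- The elementary backward step `J_i` on a pair `(S',T')`: backward jeu de
taquin in `T'`, restricted to the subshape of cells whose entries in `S'` are
`≥ i`, with the entry of `T'` lying in the cell labelled `i` in `S'`, the
transpositions being performed simultaneously in `S'`. -/
noncomputable def Jbwd (D : Set (ℕ × ℕ)) (i : ℕ)
    (p : (ℕ × ℕ → ℕ) × (ℕ × ℕ → ℕ)) : (ℕ × ℕ → ℕ) × (ℕ × ℕ → ℕ) :=
  let q := (bjIter {c | c ∈ D ∧ i ≤ p.1 c} D.ncard (p.2, p.1) (cellOf D p.1 i)).1
  (q.2, q.1)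

/-- `BJaux D k (S',T')`: for `i = 1` to `k`, perform backward jeu de taquin in
the second component, restricted to the subshape of cells whose entries in the
current first component are `≥ i`, with the entry lying in the cell labelled
`i` in the current first component, all transpositions being performed
simultaneously in the first component. -/
noncomputable def BJaux (D : Set (ℕ × ℕ)) :
    ℕ → ((ℕ × ℕ → ℕ) × (ℕ × ℕ → ℕ)) → (ℕ × ℕ → ℕ) × (ℕ × ℕ → ℕ)
  | 0, p => p
  | i + 1, p =>
    let p' := BJaux D i p
    let q := (bjIter {c | c ∈ D ∧ i + 1 ≤ p'.1 c} D.ncard (p'.2, p'.1)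
      (cellOf D p'.1 (i + 1))).1
    (q.2, q.1)

/-- `BJ(S',T') = (T,S)`. -/
noncomputable def BJ (D : Set (ℕ × ℕ)) (S' T' : ℕ × ℕ → ℕ) :
    (ℕ × ℕ → ℕ) × (ℕ × ℕ → ℕ) :=
  Prod.swap (BJaux D D.ncard (S', T'))

/-- `JfwdList D [i₁,…,iₘ] p = Jⁱ¹(Jⁱ²(… (Jⁱᵐ p) …))`. -/
noncomputable def JfwdList (D : Set (ℕ × ℕ)) :
    List ℕ → ((ℕ × ℕ → ℕ) × (ℕ × ℕ → ℕ)) → (ℕ × ℕ → ℕ) × (ℕ × ℕ → ℕ)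
  | [], p => p
  | i :: rest, p => Jfwd D i (JfwdList D rest p)

/-- `JbwdList D [i₁,…,iₘ] p = J_{i₁}(J_{i₂}(… (J_{iₘ} p) …))`. -/
noncomputable def JbwdList (D : Set (ℕ × ℕ)) :
    List ℕ → ((ℕ × ℕ → ℕ) × (ℕ × ℕ → ℕ)) → (ℕ × ℕ → ℕ) × (ℕ × ℕ → ℕ)
  | [], p => p
  | i :: rest, p => Jbwd D i (JbwdList D rest p)

/-- `π` represents a permutation of `{1,…,n}` (it is the identity elsewhere). -/
def PermOn (n : ℕ) (π : Equiv.Perm ℕ) : Prop :=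
  ∀ i, i ∉ Set.Icc 1 n → π i = i

/-- `S_π`: the tabloid obtained from `S` by replacing every entry `i` by `π i`. -/
noncomputable def permApply (D : Set (ℕ × ℕ)) (π : Equiv.Perm ℕ)
    (S : ℕ × ℕ → ℕ) : ℕ × ℕ → ℕ :=
  fun c => if c ∈ D then π (S c) else 0

/-- Forward jeu de taquin in a single filling together with the list of cells
visited by the moving entry. -/
noncomputable def fjPath (D : Set (ℕ × ℕ)) :
    ℕ → (ℕ × ℕ → ℕ) → ℕ × ℕ → (ℕ × ℕ → ℕ) × List (ℕ × ℕ)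
  | 0, f, c => (f, [c])
  | fuel + 1, f, c =>
    match fjTarget D f c with
    | none => (f, [c])
    | some c' =>
      let q := fjPath D fuel (swapCells f c c') c'
      (q.1, c :: q.2)

/-- Backward jeu de taquin inside the subshape `E` in a single filling together
with the list of cells visited by the moving entry. -/
noncomputable def bjPath (E : Set (ℕ × ℕ)) :
    ℕ → (ℕ × ℕ → ℕ) → ℕ × ℕ → (ℕ × ℕ → ℕ) × List (ℕ × ℕ)
  | 0, f, c => (f, [c])
  | fuel + 1, f, c =>
    match bjTarget E f c with
    | none => (f, [c])
    | some c' =>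
      let q := bjPath E fuel (swapCells f c c') c'
      (q.1, c :: q.2)

/-- `y` is the right or lower neighbour of `x`. -/
def Child (x y : ℕ × ℕ) : Prop := y = (x.1, x.2 + 1) ∨ y = (x.1 + 1, x.2)

theorem Child.sum {x y : ℕ × ℕ} (h : Child x y) : y.1 + y.2 = x.1 + x.2 + 1 := by
  rcases h with h | h <;> subst h <;> simp <;> omega

theorem Child.ne {x y : ℕ × ℕ} (h : Child x y) : x ≠ y := by
  intro e; subst e; have := h.sum; omega

theorem Child.asymm {x y : ℕ × ℕ} (h : Child x y) : ¬ Child y x := by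
  intro h'; have := h.sum; have := h'.sum; omega

/-- A complete forward slide. -/
inductive Slide (D : Set (ℕ × ℕ)) : (ℕ × ℕ → ℕ) → ℕ × ℕ → (ℕ × ℕ → ℕ) → Prop
  | rest (f c) (h : ∀ y ∈ D, Child c y → f c ≤ f y) : Slide D f c f
  | step (f c c' g) (hD : c' ∈ D) (hc : Child c c') (hlt : f c' < f c)
      (hmin : ∀ y ∈ D, Child c y → f c' ≤ f y) (hs : Slide D (swapCells f c c') c' g) :
      Slide D f c g

theorem fjTarget_none {D : Set (ℕ × ℕ)} {f : ℕ × ℕ → ℕ} {c : ℕ × ℕ} (hc : c ∈ D)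
    (h : fjTarget D f c = none) : ∀ y ∈ D, Child c y → f c ≤ f y := by
  intro y hy hcy
  unfold fjTarget at h
  simp only [ite_eq_right_iff, reduceCtorEq, imp_false, not_lt, le_min_iff] at h
  rcases hcy with rfl | rfl
  · have := h.1
    simpa [jval, hc, hy] using this
  · have := h.2
    simpa [jval, hc, hy] using this

theorem fjTarget_some {D : Set (ℕ × ℕ)} {f : ℕ × ℕ → ℕ} {c c' : ℕ × ℕ} (hc : c ∈ D)
    (h : fjTarget D f c = some c') : c' ∈ D ∧ Child c c' ∧ f c' < f c ∧
      ∀ y ∈ D, Child c y → f c' ≤ f y := by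
  unfold fjTarget at h
  simp only [Option.ite_none_right_eq_some, Option.some.injEq] at h
  obtain ⟨h1, h2⟩ := h
  have hjc : jval D f c = (f c : WithTop ℕ) := by simp [jval, hc]
  have key : jval D f c' < jval D f c ∧ Child c c' ∧ ∀ y, Child c y → jval D f c' ≤ jval D f y := by
    split_ifs at h2 with h3
    · subst h2
      rw [min_eq_left h3] at h1
      refine ⟨h1, Or.inl rfl, ?_⟩
      rintro y (rfl | rfl)
      · exact le_rfl
      · exact h3
    · subst h2
      have h3 := (not_le.1 h3).le
      rw [min_eq_right h3] at h1
      refine ⟨h1, Or.inr rfl, ?_⟩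
      rintro y (rfl | rfl)
      · exact h3
      · exact le_rfl
  obtain ⟨k1, k2, k3⟩ := key
  have hD : c' ∈ D := by
    by_contra hn
    simp [jval, hn] at k1
  refine ⟨hD, k2, ?_, ?_⟩
  · simpa [jval, hD, hc] using k1
  · intro y hy hcy
    simpa [jval, hD, hy] using k3 y hcy

theorem slide_fjIter {D : Set (ℕ × ℕ)} (hfin : D.Finite) (fuel : ℕ)
    (p : (ℕ × ℕ → ℕ) × (ℕ × ℕ → ℕ)) (c : ℕ × ℕ) (hc : c ∈ D)
    (hm : ({x | x ∈ D ∧ c.1 + c.2 < x.1 + x.2} : Set (ℕ × ℕ)).ncard < fuel) :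
    Slide D p.1 c (fjIter D fuel p c).1.1 := by
  induction fuel generalizing p c with
  | zero => omega
  | succ fuel ih =>
    unfold fjIter
    rcases h : fjTarget D p.1 c with _ | c'
    · exact Slide.rest _ _ (fjTarget_none hc h)
    · obtain ⟨h1, h2, h3, h4⟩ := fjTarget_some hc h
      refine Slide.step _ _ c' _ h1 h2 h3 h4 ?_
      refine ih (swapCells p.1 c c', swapCells p.2 c c') c' h1 ?_
      have : ({x | x ∈ D ∧ c'.1 + c'.2 < x.1 + x.2} : Set (ℕ × ℕ)).ncard <
          ({x | x ∈ D ∧ c.1 + c.2 < x.1 + x.2} : Set (ℕ × ℕ)).ncard := by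
        apply Set.ncard_lt_ncard
        · have := h2.sum
          refine ⟨fun x hx => ⟨hx.1, by have := hx.2; omega⟩, fun hh => ?_⟩
          have h5 := hh (show c' ∈ _ from ⟨h1, by omega⟩)
          exact absurd h5.2 (lt_irrefl _)
        · exact hfin.subset fun x hx => hx.1
      omega

theorem slide_fjRun {D : Set (ℕ × ℕ)} (hfin : D.Finite) (f : ℕ × ℕ → ℕ) (c : ℕ × ℕ)
    (hc : c ∈ D) : Slide D f c (fjRun D f c) := by
  refine slide_fjIter hfin _ (f, f) c hc ?_
  apply Set.ncard_lt_ncard _ hfin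
  exact ⟨fun x hx => hx.1, fun hh => absurd (hh hc).2 (lt_irrefl _)⟩

theorem swapCells_apply (f : ℕ × ℕ → ℕ) (a b x : ℕ × ℕ) :
    swapCells f a b x = if x = b then f a else if x = a then f b else f x := by
  unfold swapCells
  by_cases h : x = b
  · simp [h]
  · by_cases h' : x = a <;> simp [Function.update_apply, h, h']

theorem swapCells_comp (f : ℕ × ℕ → ℕ) (a b : ℕ × ℕ) :
    swapCells f a b = f ∘ (Equiv.swap a b) := by
  funext x
  rw [swapCells_apply]
  simp only [Function.comp, Equiv.swap_apply_def]
  split_ifs <;> simp_all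

/-- The invariant of a slide inside the upper set `U`. -/
structure Good (D U : Set (ℕ × ℕ)) (f : ℕ × ℕ → ℕ) (c : ℕ × ℕ) : Prop where
  sub : U ⊆ D
  mem : c ∈ U
  upper : ∀ x ∈ U, ∀ y ∈ D, Child x y → y ∈ U
  inj : Set.InjOn f D
  inc : ∀ x ∈ U, x ≠ c → ∀ y ∈ D, y ≠ c → Child x y → f x < f y
  skip : ∀ x ∈ U, Child x c → ∀ y ∈ D, Child c y → f x < f y
  par : ∀ x ∈ U, Child x c → f x < f c

theorem Good.step {D U : Set (ℕ × ℕ)} {f : ℕ × ℕ → ℕ} {c c' : ℕ × ℕ} (G : Good D U f c)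
    (hD : c' ∈ D) (hc : Child c c') (hlt : f c' < f c)
    (hmin : ∀ y ∈ D, Child c y → f c' ≤ f y) : Good D U (swapCells f c c') c' := by
  have hU : c' ∈ U := G.upper _ G.mem _ hD hc
  have hne := hc.ne
  refine ⟨G.sub, hU, G.upper, ?_, ?_, ?_, ?_⟩
  · rw [swapCells_comp]
    have hm : ∀ x ∈ D, Equiv.swap c c' x ∈ D := by
      intro x hx
      rw [Equiv.swap_apply_def]
      split_ifs
      · exact hD
      · exact G.sub G.mem
      · exact hx
    exact G.inj.comp (Equiv.injective _).injOn hm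
  · intro x hx hxc y hy hyc hxy
    simp only [swapCells_apply, hxc, hyc, if_false]
    by_cases h1 : x = c
    · subst h1
      have h2 : y ≠ x := hxy.ne.symm
      simp only [h2, if_true, if_false]
      refine lt_of_le_of_ne (hmin y hy hxy) fun e => hyc (G.inj hD hy e).symm
    · simp only [h1, if_false]
      by_cases h2 : y = c
      · subst h2
        simpa using G.skip x hx hxy c' hD hc
      · simp only [h2, if_false]
        exact G.inc x hx h1 y hy h2 hxy
  · intro x hx hxc y hy hcy
    have e1 : y ≠ c' := hcy.ne.symm
    have e2 : y ≠ c := by rintro rfl; exact hc.asymm hcy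
    have e3 : x ≠ c' := hxc.ne
    have h4 : f c' < f y := G.inc c' hU hne.symm y hy e2 hcy
    simp only [swapCells_apply, e1, e2, e3, if_false]
    split_ifs with h
    · exact h4
    · exact (G.inc x hx h c' hD hne.symm hxc).trans h4
  · intro x hx hxc
    have e3 : x ≠ c' := hxc.ne
    simp only [swapCells_apply, e3, if_false, if_true]
    split_ifs with h
    · exact hlt
    · exact (G.inc x hx h c' hD hne.symm hxc).trans hlt

theorem Slide.basic {D U : Set (ℕ × ℕ)} {f g : ℕ × ℕ → ℕ} {c : ℕ × ℕ} (h : Slide D f c g)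
    (G : Good D U f c) : (∀ x, x ∉ U → g x = f x) ∧
      (∀ x ∈ U, ∀ y ∈ D, Child x y → g x < g y) ∧
      (∀ s, Set.BijOn f D s → Set.BijOn g D s) := by
  induction h with
  | rest f c h =>
    refine ⟨fun _ _ => rfl, ?_, fun _ h => h⟩
    intro x hx y hy hxy
    by_cases h1 : x = c
    · subst h1
      exact lt_of_le_of_ne (h y hy hxy) fun e => hxy.ne (G.inj (G.sub hx) hy e)
    · by_cases h2 : y = c
      · subst h2; exact G.par x hx hxy
      · exact G.inc x hx h1 y hy h2 hxy
  | step f c c' g hD hc hlt hmin hs ih =>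
    obtain ⟨i1, i2, i3⟩ := ih (G.step hD hc hlt hmin)
    refine ⟨?_, i2, ?_⟩
    · intro x hx
      have hU : c' ∈ U := G.upper _ G.mem _ hD hc
      have e1 : x ≠ c := by rintro rfl; exact hx G.mem
      have e2 : x ≠ c' := by rintro rfl; exact hx hU
      rw [i1 x hx, swapCells_apply, if_neg e2, if_neg e1]
    · intro s hs
      apply i3
      rw [swapCells_comp]
      refine hs.comp ?_
      have hm : ∀ x ∈ D, Equiv.swap c c' x ∈ D := by
        intro x hx
        rw [Equiv.swap_apply_def]
        split_ifs
        · exact hD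
        · exact G.sub G.mem
        · exact hx
      exact ⟨hm, (Equiv.injective _).injOn, fun x hx => ⟨_, hm x hx, Equiv.swap_apply_self _ _ _⟩⟩

/-- Cells with large entries, the hole excluded. -/
def Wset (U : Set (ℕ × ℕ)) (f : ℕ × ℕ → ℕ) (c : ℕ × ℕ) (m : ℕ) : Set (ℕ × ℕ) :=
  {x | x ∈ U ∧ x ≠ c ∧ m ≤ f x}

/-- Cells with large entries. -/
def Zset (U : Set (ℕ × ℕ)) (f : ℕ × ℕ → ℕ) (m : ℕ) : Set (ℕ × ℕ) :=
  {x | x ∈ U ∧ m ≤ f x}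

theorem Wset_swap {U : Set (ℕ × ℕ)} {f : ℕ × ℕ → ℕ} {c c' : ℕ × ℕ} {m : ℕ}
    (hm : f c' < m) : Wset U (swapCells f c c') c' m = Wset U f c m := by
  ext x
  simp only [Wset, Set.mem_ofPred_eq, swapCells_apply]
  by_cases h1 : x = c'
  · subst h1; simp [hm]
  · by_cases h2 : x = c
    · subst h2; simp [h1, hm]
    · simp [h1, h2]

theorem Slide.above {D U : Set (ℕ × ℕ)} {f g : ℕ × ℕ → ℕ} {c : ℕ × ℕ} (h : Slide D f c g)
    {m : ℕ} (hm : f c < m) : Zset U g m = Wset U f c m := by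
  induction h with
  | rest f c h =>
    ext x
    simp only [Wset, Zset, Set.mem_ofPred_eq]
    by_cases h1 : x = c
    · subst h1; simp [hm]
    · simp [h1]
  | step f c c' g hD hc hlt hmin hs ih =>
    rw [ih (by simpa [swapCells_apply] using hm), Wset_swap (hlt.trans hm)]

theorem Slide.low_part {D U : Set (ℕ × ℕ)} {f g : ℕ × ℕ → ℕ} {c : ℕ × ℕ} (h : Slide D f c g)
    (G : Good D U f c) {m : ℕ} (hm : m ≤ f c) (hch : ∀ y ∈ D, Child c y → m ≤ f y) :
    Zset U g m = insert c (Wset U f c m) := by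
  induction h with
  | rest f c h =>
    ext x
    simp only [Wset, Zset, Set.mem_ofPred_eq, Set.mem_insert_iff]
    by_cases h1 : x = c
    · subst h1; simp [hm, G.mem]
    · simp [h1]
  | step f c c' g hD hc hlt hmin hs ih =>
    have hU : c' ∈ U := G.upper _ G.mem _ hD hc
    have hw : m ≤ f c' := hch c' hD hc
    rw [ih (G.step hD hc hlt hmin) (by simpa [swapCells_apply] using hm)]
    · ext x
      simp only [Wset, Set.mem_ofPred_eq, Set.mem_insert_iff, swapCells_apply]
      by_cases h1 : x = c'
      · subst h1; simp [hU, hw, hc.ne.symm]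
      · by_cases h2 : x = c
        · subst h2; simp [h1, hw, G.mem]
        · simp [h1, h2]
    · intro y hy hcy
      have e1 : y ≠ c' := hcy.ne.symm
      have e2 : y ≠ c := by rintro rfl; exact hc.asymm hcy
      simp only [swapCells_apply, e1, e2, if_false]
      exact hw.trans (G.inc c' hU hc.ne.symm y hy e2 hcy).le

theorem Slide.mid {D U : Set (ℕ × ℕ)} {f g : ℕ × ℕ → ℕ} {c : ℕ × ℕ} (h : Slide D f c g)
    (G : Good D U f c) {m : ℕ} (hm : m < f c) {a : ℕ × ℕ} (ha : a ∈ U) (hfa : f a = m) :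
    ∃ b, b ∉ Wset U f c m ∧ Zset U g m = insert b (Wset U f c m) ∧
      ((Child b a ∧ Zset U g (m + 1) = Wset U f c m) ∨
       (¬ Child b a ∧ Zset U g (m + 1) = insert b (Wset U f c (m + 1)))) := by
  induction h with
  | rest f c h =>
    refine ⟨c, fun hh => hh.2.1 rfl, ?_, Or.inr ⟨?_, ?_⟩⟩
    · exact (Slide.rest f c h).low_part G hm.le fun y hy hcy => hm.le.trans (h y hy hcy)
    · intro hca
      have := h a (G.sub ha) hca
      omega
    · exact (Slide.rest f c h).low_part G hm fun y hy hcy => hm.trans_le (h y hy hcy)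
  | step f c c' g hD hc hlt hmin hs ih =>
    have hU : c' ∈ U := G.upper _ G.mem _ hD hc
    have S := Slide.step f c c' g hD hc hlt hmin hs
    have G' := G.step hD hc hlt hmin
    rcases lt_trichotomy m (f c') with h1 | h1 | h1
    · refine ⟨c, fun hh => hh.2.1 rfl, ?_, Or.inr ⟨?_, ?_⟩⟩
      · exact S.low_part G hm.le fun y hy hcy => h1.le.trans (hmin y hy hcy)
      · intro hca
        have := hmin a (G.sub ha) hca
        omega
      · exact S.low_part G hm fun y hy hcy => h1.trans_le (hmin y hy hcy)
    · have e : a = c' := G.inj (G.sub ha) hD (hfa.trans h1)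
      subst e
      refine ⟨c, fun hh => hh.2.1 rfl, ?_, Or.inl ⟨hc, ?_⟩⟩
      · exact S.low_part G hm.le fun y hy hcy => h1.le.trans (hmin y hy hcy)
      · rw [hs.low_part (m := m + 1) G' (by simpa [swapCells_apply] using hm), Wset_swap (by omega)]
        · ext x
          simp only [Wset, Set.mem_ofPred_eq, Set.mem_insert_iff]
          constructor
          · rintro (rfl | ⟨h2, h3, h4⟩)
            · exact ⟨ha, hc.ne.symm, hfa.ge⟩
            · exact ⟨h2, h3, by omega⟩
          · rintro ⟨h2, h3, h4⟩
            by_cases h5 : x = a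
            · exact Or.inl h5
            · refine Or.inr ⟨h2, h3, ?_⟩
              have : f x ≠ f a := fun e => h5 (G.inj (G.sub h2) hD e)
              omega
        · intro y hy hcy
          have e1 : y ≠ a := hcy.ne.symm
          have e2 : y ≠ c := by rintro rfl; exact hc.asymm hcy
          simp only [swapCells_apply, e1, e2, if_false]
          have := G.inc a hU hc.ne.symm y hy e2 hcy
          omega
    · have e1 : a ≠ c' := by rintro rfl; omega
      have e2 : a ≠ c := by rintro rfl; omega
      have := ih G' (by simpa [swapCells_apply] using hm) (by simp [swapCells_apply, e1, e2, hfa])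
      rwa [Wset_swap h1, Wset_swap (by omega)] at this

/-- The local growth rule (symmetric in both directions). -/
structure Rule (π : Equiv.Perm ℕ) (k m : ℕ) (A B C E : Set (ℕ × ℕ)) : Prop where
  r1 : π k < m → A = B ∧ C = E
  r2 : π.symm m < k → A = C ∧ B = E
  r3 : m = π k → B = E ∧ C = E
  r4 : m < π k → k < π.symm m → ∃ h a, h ≠ a ∧ h ∉ E ∧ a ∉ E ∧ A = insert h (insert a E) ∧
    (((Child h a ∨ Child a h) ∧ B = C ∧ B = insert a E) ∨
     (¬ (Child h a ∨ Child a h) ∧ B = insert a E ∧ C = insert h E))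

theorem Rule.symm {π : Equiv.Perm ℕ} {k m : ℕ} {A B C E : Set (ℕ × ℕ)}
    (R : Rule π k m A B C E) : Rule π.symm m k A C B E := by
  refine ⟨R.r2, fun h => R.r1 (by simpa using h), fun h => ?_, fun h1 h2 => ?_⟩
  · have : m = π k := by simp [h]
    exact (R.r3 this).symm
  · obtain ⟨h, a, hne, hh, ha, hA, H⟩ := R.r4 (by simpa using h2) h1
    rcases H with ⟨H1, H2, H3⟩ | ⟨H1, H2, H3⟩
    · exact ⟨h, a, hne, hh, ha, hA, Or.inl ⟨H1, H2.symm, H2 ▸ H3⟩⟩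
    · refine ⟨a, h, hne.symm, ha, hh, by rw [hA, Set.insert_comm], Or.inr ⟨?_, H3, H2⟩⟩
      tauto

theorem Rule.det {π : Equiv.Perm ℕ} {k m : ℕ} {A B C C' E : Set (ℕ × ℕ)}
    (R : Rule π k m A B C E) (R' : Rule π k m A B C' E) : C = C' := by
  rcases lt_trichotomy m (π k) with h | h | h
  · rcases lt_trichotomy k (π.symm m) with h' | h' | h'
    · obtain ⟨x, a, hne, hx, ha, hA, H⟩ := R.r4 h h'
      obtain ⟨x', a', hne', hx', ha', hA', H'⟩ := R'.r4 h h'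
      have hB : B = insert a E := by rcases H with H | H; exacts [H.2.2, H.2.1]
      have hB' : B = insert a' E := by rcases H' with H | H; exacts [H.2.2, H.2.1]
      have e1 : a = a' := by
        have : a ∈ insert a' E := by rw [← hB', hB]; exact Set.mem_insert _ _
        rcases this with h | h
        · exact h
        · exact absurd h ha
      subst e1
      have e2 : x = x' := by
        have : x ∈ insert x' (insert a E) := by rw [← hA', hA]; exact Set.mem_insert _ _
        rcases this with h | h | h
        · exact h
        · exact absurd h hne
        · exact absurd h hx
      subst e2
      rcases H with H | H <;> rcases H' with H' | H'
      · rw [← H.2.1, H'.2.1]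
      · exact absurd H.1 H'.1
      · exact absurd H'.1 H.1
      · rw [H.2.2, H'.2.2]
    · subst h'; simp at h
    · rw [← (R.r2 h').1, (R'.r2 h').1]
  · rw [(R.r3 h).2, (R'.r3 h).2]
  · rw [(R.r1 h).2, (R'.r1 h).2]

/-- The growth diagram of modified jeu de taquin. -/
noncomputable def tau (D : Set (ℕ × ℕ)) (S T : ℕ × ℕ → ℕ) (k : ℕ) : ℕ × ℕ → ℕ :=
  MJaux D S D.ncard (D.ncard + 1 - k) T

/-- Corner sets of the growth diagram. -/
def Eset (D : Set (ℕ × ℕ)) (S T : ℕ × ℕ → ℕ) (k m : ℕ) : Set (ℕ × ℕ) :=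
  {x | x ∈ D ∧ k ≤ S x ∧ m ≤ tau D S T k x}

theorem IsTabloid.finite {D : Set (ℕ × ℕ)} {S : ℕ × ℕ → ℕ} (h : IsTabloid D S) : D.Finite :=
  h.1.finite_iff_finite.2 (Set.finite_Icc _ _)

theorem cellOf_spec {D : Set (ℕ × ℕ)} {S : ℕ × ℕ → ℕ} (h : IsTabloid D S) {k : ℕ}
    (hk : 1 ≤ k) (hk' : k ≤ D.ncard) : cellOf D S k ∈ D ∧ S (cellOf D S k) = k := by
  obtain ⟨x, hx, e⟩ := h.1.surjOn ⟨hk, hk'⟩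
  exact Classical.epsilon_spec (p := fun c => c ∈ D ∧ S c = k) ⟨x, hx, e⟩

theorem IsStandard.child {D : Set (ℕ × ℕ)} {S : ℕ × ℕ → ℕ} (h : IsStandard D S)
    {x y : ℕ × ℕ} (hx : x ∈ D) (hy : y ∈ D) (hxy : Child x y) : S x < S y := by
  rcases hxy with rfl | rfl
  · exact (h.2 x hx).1 hy
  · exact (h.2 x hx).2 hy

theorem tau_step (D : Set (ℕ × ℕ)) (S T : ℕ × ℕ → ℕ) {k : ℕ} (hk : 1 ≤ k)
    (hk' : k ≤ D.ncard) : tau D S T k = fjRun D (tau D S T (k + 1)) (cellOf D S k) := by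
  unfold tau
  have e : D.ncard + 1 - k = (D.ncard + 1 - (k + 1)) + 1 := by omega
  rw [e, MJaux]
  congr 2
  omega

/-- The invariant of modified jeu de taquin. -/
structure MJInv (D : Set (ℕ × ℕ)) (S T t : ℕ × ℕ → ℕ) (k : ℕ) : Prop where
  bij : IsTabloid D t
  old : ∀ x, S x < k → t x = T x
  inc : ∀ x ∈ D, k ≤ S x → ∀ y ∈ D, Child x y → t x < t y

theorem MJInv.good {D : Set (ℕ × ℕ)} {S T t : ℕ × ℕ → ℕ} {k : ℕ} (hS : IsStandard D S)
    (I : MJInv D S T t (k + 1)) (hk : 1 ≤ k) (hk' : k ≤ D.ncard) :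
    Good D {x | x ∈ D ∧ k ≤ S x} t (cellOf D S k) := by
  obtain ⟨c1, c2⟩ := cellOf_spec hS.1 hk hk'
  have nopar : ∀ x ∈ {x | x ∈ D ∧ k ≤ S x}, ¬ Child x (cellOf D S k) := by
    intro x hx h
    have := hS.child hx.1 c1 h
    have := hx.2
    omega
  refine ⟨fun x hx => hx.1, ⟨c1, c2.ge⟩, ?_, I.bij.1.injOn, ?_, ?_, ?_⟩
  · intro x hx y hy hxy
    exact ⟨hy, hx.2.trans (hS.child hx.1 hy hxy).le⟩
  · intro x hx hxc y hy hyc hxy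
    refine I.inc x hx.1 ?_ y hy hxy
    have : S x ≠ k := fun e => hxc (hS.1.1.injOn hx.1 c1 (e.trans c2.symm))
    have := hx.2
    omega
  · intro x hx h; exact absurd h (nopar x hx)
  · intro x hx h; exact absurd h (nopar x hx)

theorem inv_tau {D : Set (ℕ × ℕ)} {S T : ℕ × ℕ → ℕ} (hS : IsStandard D S)
    (hT : IsTabloid D T) (j : ℕ) (hj : j ≤ D.ncard) :
    MJInv D S T (tau D S T (D.ncard + 1 - j)) (D.ncard + 1 - j) := by
  induction j with
  | zero =>
    have e : tau D S T (D.ncard + 1 - 0) = T := by simp [tau, MJaux]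
    rw [e]
    refine ⟨hT, fun _ _ => rfl, ?_⟩
    intro x hx h
    have := (hS.1.1.mapsTo hx).2
    omega
  | succ j ih =>
    have I := ih (by omega)
    obtain ⟨k, hk⟩ : ∃ k, k = D.ncard + 1 - (j + 1) := ⟨_, rfl⟩
    have hk1 : D.ncard + 1 - j = k + 1 := by omega
    rw [hk1] at I
    rw [← hk]
    have h1 : 1 ≤ k := by omega
    have h2 : k ≤ D.ncard := by omega
    have G := I.good hS h1 h2
    obtain ⟨c1, c2⟩ := cellOf_spec hS.1 h1 h2
    have Sl := slide_fjRun hS.1.finite (tau D S T (k + 1)) _ c1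
    rw [← tau_step D S T h1 h2] at Sl
    obtain ⟨b1, b2, b3⟩ := Sl.basic G
    refine ⟨⟨b3 _ I.bij.1, ?_⟩, ?_, ?_⟩
    · intro x hx
      rw [b1 x (fun h => hx h.1), I.bij.2 x hx]
    · intro x hx
      rw [b1 x (fun h => absurd h.2 (by omega)), I.old x (by omega)]
    · intro x hx hkx y hy hxy
      exact b2 x ⟨hx, hkx⟩ y hy hxy

theorem inv_tau' {D : Set (ℕ × ℕ)} {S T : ℕ × ℕ → ℕ} (hS : IsStandard D S)
    (hT : IsTabloid D T) (k : ℕ) (hk : 1 ≤ k) (hk' : k ≤ D.ncard + 1) :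
    MJInv D S T (tau D S T k) k := by
  have := inv_tau hS hT (D.ncard + 1 - k) (by omega)
  have e : D.ncard + 1 - (D.ncard + 1 - k) = k := by omega
  rwa [e] at this

theorem permApply_tabloid {D : Set (ℕ × ℕ)} {S : ℕ × ℕ → ℕ} (hS : IsTabloid D S)
    {π : Equiv.Perm ℕ} (hπ : PermOn D.ncard π) : IsTabloid D (permApply D π S) := by
  have hmem : ∀ i, i ∈ Set.Icc 1 D.ncard → π i ∈ Set.Icc 1 D.ncard := by
    intro i hi
    by_contra hn
    have := hπ _ hn
    have := π.injective this
    rw [this] at hn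
    exact hn hi
  have hmem' : ∀ i, i ∈ Set.Icc 1 D.ncard → π.symm i ∈ Set.Icc 1 D.ncard := by
    intro i hi
    by_contra hn
    have := hπ _ hn
    rw [Equiv.apply_symm_apply] at this
    rw [← this] at hn
    exact hn hi
  have hb : Set.BijOn π (Set.Icc 1 D.ncard) (Set.Icc 1 D.ncard) :=
    ⟨hmem, π.injective.injOn, fun x hx => ⟨_, hmem' x hx, by simp⟩⟩
  refine ⟨(hb.comp hS.1).congr fun x hx => ?_, fun c hc => by simp [permApply, hc]⟩
  simp [permApply, hx]

theorem Eset_rule {D : Set (ℕ × ℕ)} {S : ℕ × ℕ → ℕ} (hS : IsStandard D S)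
    {π : Equiv.Perm ℕ} (hπ : PermOn D.ncard π) {k m : ℕ} (hk : 1 ≤ k) (hk' : k ≤ D.ncard)
    (hm : 1 ≤ m) (hm' : m ≤ D.ncard) :
    Rule π k m (Eset D S (permApply D π S) k m) (Eset D S (permApply D π S) (k + 1) m)
      (Eset D S (permApply D π S) k (m + 1)) (Eset D S (permApply D π S) (k + 1) (m + 1)) := by
  set T := permApply D π S with hTdef
  have hT : IsTabloid D T := permApply_tabloid hS.1 hπ
  have I := inv_tau' hS hT (k + 1) (by omega) (by omega)
  have I0 := inv_tau' hS hT k hk (by omega)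
  have G := I.good hS hk hk'
  obtain ⟨c1, c2⟩ := cellOf_spec hS.1 hk hk'
  have Sl := slide_fjRun hS.1.finite (tau D S T (k + 1)) _ c1
  rw [← tau_step D S T hk hk'] at Sl
  set c := cellOf D S k with hc
  set U : Set (ℕ × ℕ) := {x | x ∈ D ∧ k ≤ S x} with hU
  have hTx : ∀ x ∈ D, T x = π (S x) := fun x hx => by simp [hTdef, permApply, hx]
  have hv : tau D S T (k + 1) c = π k := by
    rw [I.old c (by omega), hTx c c1, c2]
  have hZ : ∀ m, Eset D S T k m = Zset U (tau D S T k) m := by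
    intro m; ext x; simp [Eset, Zset, hU, and_assoc]
  have hW : ∀ m, Eset D S T (k + 1) m = Wset U (tau D S T (k + 1)) c m := by
    intro m; ext x
    simp only [Eset, Wset, hU, Set.mem_ofPred_eq]
    constructor
    · rintro ⟨h1, h2, h3⟩
      exact ⟨⟨h1, by omega⟩, by rintro rfl; omega, h3⟩
    · rintro ⟨⟨h1, h2⟩, h3, h4⟩
      have : S x ≠ k := fun e => h3 (hS.1.1.injOn h1 c1 (e.trans c2.symm))
      exact ⟨h1, by omega, h4⟩
  refine ⟨?_, ?_, ?_, ?_⟩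
  · intro h
    rw [hZ, hZ, hW, hW]
    exact ⟨Sl.above (by omega), Sl.above (by omega)⟩
  · intro h
    -- the value `m` sits outside the active region
    obtain ⟨b, hb, hbm⟩ := hT.1.surjOn ⟨hm, hm'⟩
    have hSb : S b < k := by
      rw [hTx b hb] at hbm
      rw [← hbm] at h
      simpa using h
    constructor
    · ext x
      simp only [Eset, Set.mem_ofPred_eq]
      refine and_congr_right fun hx => and_congr_right fun hkx => ?_
      have : tau D S T k x ≠ m := by
        intro e
        have : tau D S T k b = m := by rw [I0.old b hSb, hbm]
        have := I0.bij.1.injOn hx hb (e.trans this.symm)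
        subst this; omega
      omega
    · ext x
      simp only [Eset, Set.mem_ofPred_eq]
      refine and_congr_right fun hx => and_congr_right fun hkx => ?_
      have : tau D S T (k + 1) x ≠ m := by
        intro e
        have : tau D S T (k + 1) b = m := by rw [I.old b (by omega), hbm]
        have := I.bij.1.injOn hx hb (e.trans this.symm)
        subst this; omega
      omega
  · intro h
    refine ⟨?_, ?_⟩
    · ext x
      simp only [Eset, Set.mem_ofPred_eq]
      refine and_congr_right fun hx => and_congr_right fun hkx => ?_
      have : tau D S T (k + 1) x ≠ m := by
        intro e
        have := I.bij.1.injOn hx c1 (e.trans (h.trans hv.symm))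
        subst this; omega
      omega
    · rw [hZ, hW]
      exact Sl.above (by omega)
  · intro h1 h2
    obtain ⟨a, ha, ham⟩ := I.bij.1.surjOn ⟨hm, hm'⟩
    have hka : k + 1 ≤ S a := by
      by_contra hn
      have e := I.old a (by omega)
      rw [ham, hTx a ha] at e
      rw [e] at h2
      simp at h2
      omega
    have haU : a ∈ U := ⟨ha, by omega⟩
    have hac : a ≠ c := by rintro rfl; omega
    obtain ⟨b, hb, hbZ, H⟩ := Sl.mid G (by omega) haU ham
    have hWm : Wset U (tau D S T (k + 1)) c m = insert a (Wset U (tau D S T (k + 1)) c (m + 1)) := by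
      ext x
      simp only [Wset, Set.mem_ofPred_eq, Set.mem_insert_iff]
      constructor
      · rintro ⟨h3, h4, h5⟩
        by_cases h6 : x = a
        · exact Or.inl h6
        · have : tau D S T (k + 1) x ≠ m := fun e => h6 (I.bij.1.injOn h3.1 ha (e.trans ham.symm))
          exact Or.inr ⟨h3, h4, by omega⟩
      · rintro (rfl | ⟨h3, h4, h5⟩)
        · exact ⟨haU, hac, ham.ge⟩
        · exact ⟨h3, h4, by omega⟩
    have haW : a ∉ Wset U (tau D S T (k + 1)) c (m + 1) := by
      intro h; have := h.2.2; omega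
    have hbD : b ∈ D := by
      have : b ∈ Zset U (tau D S T k) m := by rw [hbZ]; exact Set.mem_insert _ _
      exact this.1.1
    have hnab : ¬ Child a b := by
      intro hab
      apply hb
      have l1 := I.inc a ha hka b hbD hab
      have l2 := hS.child ha hbD hab
      exact ⟨⟨hbD, by omega⟩, by rintro rfl; omega, by omega⟩
    rw [hZ, hZ, hW, hW]
    refine ⟨b, a, ?_, ?_, haW, by rw [hbZ, hWm], ?_⟩
    · rintro rfl
      exact hb (by rw [hWm]; exact Set.mem_insert _ _)
    · intro h; exact hb (by rw [hWm]; exact Set.mem_insert_of_mem _ h)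
    · rcases H with ⟨H1, H2⟩ | ⟨H1, H2⟩
      · exact Or.inl ⟨Or.inl H1, H2.symm, hWm⟩
      · exact Or.inr ⟨by tauto, hWm, H2⟩

theorem PermOn.symm {n : ℕ} {π : Equiv.Perm ℕ} (h : PermOn n π) : PermOn n π.symm := by
  intro i hi
  rw [Equiv.symm_apply_eq, h i hi]

theorem Eset_one {D : Set (ℕ × ℕ)} {S T : ℕ × ℕ → ℕ} (hS : IsStandard D S)
    (hT : IsTabloid D T) {k : ℕ} (hk : 1 ≤ k) (hk' : k ≤ D.ncard + 1) :
    Eset D S T k 1 = {x | x ∈ D ∧ k ≤ S x} := by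
  ext x
  simp only [Eset, Set.mem_ofPred_eq]
  have I := inv_tau' hS hT k hk hk'
  constructor
  · rintro ⟨h1, h2, _⟩; exact ⟨h1, h2⟩
  · rintro ⟨h1, h2⟩; exact ⟨h1, h2, (I.bij.1.mapsTo h1).1⟩

theorem Eset_first {D : Set (ℕ × ℕ)} {S T : ℕ × ℕ → ℕ} (hS : IsStandard D S) (m : ℕ) :
    Eset D S T 1 m = {x | x ∈ D ∧ m ≤ MJ D S T x} := by
  ext x
  simp only [Eset, Set.mem_ofPred_eq, MJ, tau, Nat.add_sub_cancel]
  constructor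
  · rintro ⟨h1, _, h2⟩; exact ⟨h1, h2⟩
  · rintro ⟨h1, h2⟩; exact ⟨h1, (hS.1.1.mapsTo h1).1, h2⟩

theorem Eset_last_row {D : Set (ℕ × ℕ)} {S T : ℕ × ℕ → ℕ} (hS : IsStandard D S) (m : ℕ) :
    Eset D S T (D.ncard + 1) m = ∅ := by
  ext x
  simp only [Eset, Set.mem_ofPred_eq, Set.mem_empty_iff_false, iff_false]
  rintro ⟨h1, h2, _⟩
  have := (hS.1.1.mapsTo h1).2
  omega

theorem Eset_last_col {D : Set (ℕ × ℕ)} {S T : ℕ × ℕ → ℕ} (hS : IsStandard D S)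
    (hT : IsTabloid D T) {k : ℕ} (hk : 1 ≤ k) (hk' : k ≤ D.ncard + 1) :
    Eset D S T k (D.ncard + 1) = ∅ := by
  ext x
  simp only [Eset, Set.mem_ofPred_eq, Set.mem_empty_iff_false, iff_false]
  rintro ⟨h1, _, h2⟩
  have := ((inv_tau' hS hT k hk hk').bij.1.mapsTo h1).2
  omega

theorem MJ_reverse {D : Set (ℕ × ℕ)} {P Q : ℕ × ℕ → ℕ} (hP : IsStandard D P)
    (hQ : IsStandard D Q) {π : Equiv.Perm ℕ} (hπ : PermOn D.ncard π)
    (h : MJ D P (permApply D π P) = Q) : MJ D Q (permApply D π.symm Q) = P := by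
  have hT := permApply_tabloid hP.1 hπ
  have hT' := permApply_tabloid hQ.1 hπ.symm
  have key : ∀ j, j ≤ D.ncard → ∀ i, i ≤ D.ncard →
      Eset D Q (permApply D π.symm Q) (D.ncard + 1 - j) (i + 1) =
        Eset D P (permApply D π P) (i + 1) (D.ncard + 1 - j) := by
    intro j
    induction j with
    | zero =>
      intro _ i hi
      rw [Nat.sub_zero, Eset_last_row hQ, Eset_last_col hP hT (by omega) (by omega)]
    | succ j ihj =>
      intro hj i
      obtain ⟨m, hm⟩ : ∃ m, m = D.ncard + 1 - (j + 1) := ⟨_, rfl⟩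
      have hm1 : D.ncard + 1 - j = m + 1 := by omega
      have ihj := ihj (by omega)
      rw [hm1] at ihj
      rw [← hm]
      induction i with
      | zero =>
        intro _
        rw [Eset_one hQ hT' (by omega) (by omega), Eset_first hP, h]
      | succ i ihi =>
        intro hi
        have R := Eset_rule hQ hπ.symm (k := m) (m := i + 1) (by omega) (by omega) (by omega)
          (by omega)
        have R' := (Eset_rule hP hπ (k := i + 1) (m := m) (by omega) (by omega) (by omega)
          (by omega)).symm
        rw [ihi (by omega), ihj i (by omega), ihj (i + 1) hi] at R
        exact R.det R'
  have I := inv_tau' hQ hT' 1 le_rfl (by omega)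
  have hMJ : tau D Q (permApply D π.symm Q) 1 = MJ D Q (permApply D π.symm Q) := by
    simp [tau, MJ]
  rw [hMJ] at I
  have hsets : ∀ i, 1 ≤ i → i ≤ D.ncard →
      ({x | x ∈ D ∧ i ≤ MJ D Q (permApply D π.symm Q) x} : Set (ℕ × ℕ)) =
        {x | x ∈ D ∧ i ≤ P x} := by
    intro i hi hi'
    have k1 := key D.ncard le_rfl (i - 1) (by omega)
    have e1 : D.ncard + 1 - D.ncard = 1 := by omega
    have e2 : i - 1 + 1 = i := by omega
    rw [e1, e2, Eset_first hQ, Eset_one hP hT hi (by omega)] at k1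
    exact k1
  funext x
  by_cases hx : x ∈ D
  · have a1 := I.bij.1.mapsTo hx
    have a2 := hP.1.1.mapsTo hx
    apply le_antisymm
    · have : x ∈ ({x | x ∈ D ∧ MJ D Q (permApply D π.symm Q) x ≤ P x} : Set (ℕ × ℕ)) := by
        have := (Set.ext_iff.1 (hsets _ a1.1 a1.2) x).1 ⟨hx, le_rfl⟩
        exact ⟨hx, this.2⟩
      exact this.2
    · exact ((Set.ext_iff.1 (hsets _ a2.1 a2.2) x).2 ⟨hx, le_rfl⟩).2
  · rw [I.bij.2 x hx, hP.1.2 x hx]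

/-- for standard skew tableaux `P, Q` of the same (shifted or
unshifted) skew shape, the set of permutations `π` of `{1,…,n}` with
`MJ_P(P_π) = Q` equals the set of permutations `π` with `MJ_Q(Q_{π⁻¹}) = P`. -/
theorem perm_sets_eq (sh : SkewShape) (P Q : ℕ × ℕ → ℕ)
    (hP : IsStandard sh.cells P) (hQ : IsStandard sh.cells Q) :
    {π : Equiv.Perm ℕ | PermOn sh.cells.ncard π ∧
        MJ sh.cells P (permApply sh.cells π P) = Q} =
      {π : Equiv.Perm ℕ | PermOn sh.cells.ncard π ∧
        MJ sh.cells Q (permApply sh.cells π.symm Q) = P} := by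
  ext π
  constructor
  · rintro ⟨h1, h2⟩
    exact ⟨h1, MJ_reverse hP hQ h1 h2⟩
  · rintro ⟨h1, h2⟩
    refine ⟨h1, ?_⟩
    have := MJ_reverse hQ hP h1.symm h2
    rwa [Equiv.symm_symm] at this
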